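/- arXiv:2406.17791 — 8 statements merged into one kernel-verified Lean document; each statement's English description precedes it below -/
import Mathlib

section
/- Let c ∈ [0,1], e = exp(1), ρ = (1 − c/e)^{−1}, and let w be the bent welfare rule w(j) = (1−c)j + c·min(j,1). Define the utility rule f by f(1) = 1 and f(j+1) = max{ j·f(j) − ρ·w(j) + 1, 1 − c } for j ≥ 1, and let u(j) = Σ_{i=1}^{j} f(i) be the induced distribution rule. Then the one-round efficiency guarantee of this design satisfies pob({w}, u; 1) ≤ 1 + (c−3)c/((2−c)e + c): for every ε > 0 there exists a resource allocation game in which every welfare rule equals w and every distribution rule equals u, together with a one-round walk from the empty joint action whose final joint action has efficiency at most 1 + (c−3)c/((2−c)e + c) + ε. -/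
/-!
Submodular resource allocation games, round-robin best-response walks,
transient (`pob`) and asymptotic (`pobInf`) efficiency guarantees.
-/

/-- A resource allocation game: `n` players, `d` resources, finite action
sets (each containing the empty action), a welfare rule `w r` and a
distribution rule `u r` for each resource `r`. -/
structure ResGame where
  n : ℕ
  npos : 0 < n
  d : ℕ
  actions : Fin n → Finset (Finset (Fin d))
  empty_mem : ∀ i, ∅ ∈ actions i
  w : Fin d → ℕ → ℝ
  u : Fin d → ℕ → ℝ

namespace ResGame

variable (G : ResGame)

/-- A joint action is valid if every player's action belongs to her action set. -/
def Valid (a : Fin G.n → Finset (Fin G.d)) : Prop := ∀ i, a i ∈ G.actions i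

/-- `|a|_r` : the number of players selecting resource `r` in the joint action `a`. -/
def cnt (a : Fin G.n → Finset (Fin G.d)) (r : Fin G.d) : ℕ :=
  (Finset.univ.filter (fun i => r ∈ a i)).card

/-- System welfare `W(a) = Σ_r w_r(|a|_r)`. -/
noncomputable def W (a : Fin G.n → Finset (Fin G.d)) : ℝ :=
  ∑ r : Fin G.d, G.w r (G.cnt a r)

/-- The common utility `U(a) = Σ_r u_r(|a|_r)` of each player. -/
noncomputable def U (a : Fin G.n → Finset (Fin G.d)) : ℝ :=
  ∑ r : Fin G.d, G.u r (G.cnt a r)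

/-- `b` is a best response of player `i` against `a_{-i}`. -/
def BestResponse (i : Fin G.n) (a : Fin G.n → Finset (Fin G.d))
    (b : Finset (Fin G.d)) : Prop :=
  b ∈ G.actions i ∧
    ∀ b' ∈ G.actions i, G.U (Function.update a i b') ≤ G.U (Function.update a i b)

/-- The round-robin player updating at step `τ`. -/
def player (τ : ℕ) : Fin G.n := ⟨τ % G.n, Nat.mod_lt τ G.npos⟩

/-- At step `τ` the round-robin player switches to a best response while
all other players keep their actions. -/
def Step (traj : ℕ → Fin G.n → Finset (Fin G.d)) (τ : ℕ) : Prop :=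
  G.BestResponse (G.player τ) (traj τ) (traj (τ + 1) (G.player τ)) ∧
    ∀ i, i ≠ G.player τ → traj (τ + 1) i = traj τ i

/-- A finite best-response walk of `m` steps starting from the empty joint action. -/
def IsWalk (m : ℕ) (traj : ℕ → Fin G.n → Finset (Fin G.d)) : Prop :=
  traj 0 = (fun _ => ∅) ∧ ∀ τ < m, G.Step traj τ

/-- An infinite round-robin best-response trajectory from the empty joint action. -/
def IsTraj (traj : ℕ → Fin G.n → Finset (Fin G.d)) : Prop :=
  traj 0 = (fun _ => ∅) ∧ ∀ τ, G.Step traj τ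

/-- The optimal welfare `max_{a ∈ A} W(a)`. -/
noncomputable def maxW : ℝ := sSup {x | ∃ a, G.Valid a ∧ x = G.W a}

/-- Efficiency of a joint action. -/
noncomputable def eff (a : Fin G.n → Finset (Fin G.d)) : ℝ := G.W a / G.maxW

/-- `pob(G; k)` : the worst efficiency of the final joint action of a `k`-round walk. -/
noncomputable def pob (k : ℕ) : ℝ :=
  sInf {x | ∃ traj, G.IsWalk (k * G.n) traj ∧ x = G.eff (traj (k * G.n))}

/-- `pob(G; ∞)` : the worst efficiency over joint actions at which some infinite
round-robin best-response trajectory from the empty joint action eventually stabilizes. -/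
noncomputable def pobInf : ℝ :=
  sInf {x | ∃ traj astar, G.IsTraj traj ∧ (∃ T, ∀ t ≥ T, traj t = astar) ∧
    x = G.eff astar}

/-- Nash equilibrium: no unilateral deviation is profitable. -/
def IsNash (a : Fin G.n → Finset (Fin G.d)) : Prop :=
  G.Valid a ∧ ∀ i, ∀ b ∈ G.actions i, G.U (Function.update a i b) ≤ G.U a

/-- Price of anarchy of the game `G`. -/
noncomputable def poa : ℝ := sInf {x | ∃ a, G.IsNash a ∧ x = G.eff a}

end ResGame

/-- A welfare rule: `w 0 = 0`, `w 1 > 0`, nondecreasing and concave. -/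
def IsWelfareRule (w : ℕ → ℝ) : Prop :=
  w 0 = 0 ∧ 0 < w 1 ∧ Monotone w ∧
    ∀ j, w (j + 2) - w (j + 1) ≤ w (j + 1) - w j

/-- Curvature at most `c`: the limit of the first differences is at least `(1-c)·w(1)`. -/
def CurvatureLe (c : ℝ) (w : ℕ → ℝ) : Prop :=
  ∃ L, Filter.Tendsto (fun n => w (n + 1) - w n) Filter.atTop (nhds L) ∧
    (1 - c) * w 1 ≤ L

/-- A distribution rule for the welfare rule `w`. -/
def IsDistRule (w u : ℕ → ℝ) : Prop :=
  u 0 = 0 ∧ u 1 = w 1 ∧ Monotone u ∧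
    ∀ j, u (j + 2) - u (j + 1) ≤ u (j + 1) - u j

/-- A utility design on a set `WW` of welfare rules. -/
def IsUtilityDesign (WW : Set (ℕ → ℝ)) (Γ : (ℕ → ℝ) → (ℕ → ℝ)) : Prop :=
  ∀ w ∈ WW, IsDistRule w (Γ w)

/-- `G ∈ 𝒢_{WW,Γ}` : every welfare rule lies in `WW` and every distribution
rule is the one assigned by the design `Γ`. -/
def InClass (WW : Set (ℕ → ℝ)) (Γ : (ℕ → ℝ) → (ℕ → ℝ)) (G : ResGame) : Prop :=
  ∀ r, G.w r ∈ WW ∧ G.u r = Γ (G.w r)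

/-- `pob(WW, Γ; k)`. -/
noncomputable def pobClass (WW : Set (ℕ → ℝ)) (Γ : (ℕ → ℝ) → (ℕ → ℝ)) (k : ℕ) : ℝ :=
  sInf {x | ∃ G : ResGame, InClass WW Γ G ∧ x = G.pob k}

/-- `pob(WW, Γ; ∞)`. -/
noncomputable def pobInfClass (WW : Set (ℕ → ℝ)) (Γ : (ℕ → ℝ) → (ℕ → ℝ)) : ℝ :=
  sInf {x | ∃ G : ResGame, InClass WW Γ G ∧ x = G.pobInf}

/-- `PoA(WW, Γ)`. -/
noncomputable def poaClass (WW : Set (ℕ → ℝ)) (Γ : (ℕ → ℝ) → (ℕ → ℝ)) : ℝ :=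
  sInf {x | ∃ G : ResGame, InClass WW Γ G ∧ x = G.poa}

/-- `pob*(WW; k)` : optimal transient guarantee over all utility designs. -/
noncomputable def pobStar (WW : Set (ℕ → ℝ)) (k : ℕ) : ℝ :=
  sSup {x | ∃ Γ, IsUtilityDesign WW Γ ∧ x = pobClass WW Γ k}

/-- `pob*(WW; ∞)` : optimal asymptotic guarantee over all utility designs. -/
noncomputable def pobInfStar (WW : Set (ℕ → ℝ)) : ℝ :=
  sSup {x | ∃ Γ, IsUtilityDesign WW Γ ∧ x = pobInfClass WW Γ}

/-- The set of all welfare rules with curvature at most `c`. -/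
def curvW (c : ℝ) : Set (ℕ → ℝ) := {w | IsWelfareRule w ∧ CurvatureLe c w}

/-- The bent welfare rule `w(j) = (1-c)j + c·min(j,1)` of curvature `c`. -/
noncomputable def bentW (c : ℝ) (j : ℕ) : ℝ := (1 - c) * j + c * min (j : ℝ) 1

/-- The asymptotically optimal utility rule for the bent welfare rule:
`f(1) = 1`, `f(j+1) = max{ j·f(j) − ρ·w(j) + 1, 1 − c }` with `ρ = (1 - c/e)⁻¹`. -/
noncomputable def fRule (c : ℝ) : ℕ → ℝ
  | 0 => 0
  | 1 => 1
  | (j + 2) => max ((j + 1 : ℝ) * fRule c (j + 1) -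
      (1 - c / Real.exp 1)⁻¹ * bentW c (j + 1) + 1) (1 - c)

/-- The induced distribution rule `u(j) = Σ_{i=1}^{j} f(i)`. -/
noncomputable def uRule (c : ℝ) (j : ℕ) : ℝ := ∑ i ∈ Finset.Icc 1 j, fRule c i

/-- The one-round guarantee over games whose welfare rules all equal `w` and
whose distribution rules all equal `u`. -/
noncomputable def pobWU (w u : ℕ → ℝ) (k : ℕ) : ℝ :=
  sInf {x | ∃ G : ResGame, (∀ r, G.w r = w ∧ G.u r = u) ∧ x = G.pob k}

/-- Number of players whose action contains the resource `x`. -/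
def load {κ : Type*} [DecidableEq κ] {N : ℕ} (S : Fin N → Finset κ) (x : κ) : ℕ :=
  (Finset.univ.filter (fun i => x ∈ S i)).card

/-- Number of players moving before `i` whose action contains the resource `x`. -/
def loadBefore {κ : Type*} [DecidableEq κ] {N : ℕ} (S : Fin N → Finset κ) (i : Fin N)
    (x : κ) : ℕ :=
  (Finset.univ.filter (fun j => j < i ∧ x ∈ S j)).card

lemma load_update_truncated {κ : Type*} [DecidableEq κ] {N : ℕ} (A : Fin N → Finset κ)
    (i : Fin N) (b : Finset κ) (x : κ) :
    load (Function.update (fun j : Fin N => if j.val < i.val then A j else ∅) i b) x =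
      loadBefore A i x + if x ∈ b then 1 else 0 := by
  have key (j : Fin N) :
      x ∈ Function.update (fun j : Fin N => if j.val < i.val then A j else ∅) i b j ↔
        (j = i ∧ x ∈ b) ∨ (j < i ∧ x ∈ A j) := by
    rcases eq_or_ne j i with rfl | hj
    · simp
    · by_cases hlt : j < i <;> simp [hj, hlt]
  simp only [load, loadBefore, key]
  split_ifs with hb
  · rw [← Finset.card_insert_of_notMem (a := i) (by simp)]
    exact congrArg Finset.card (by ext j; simp [hb])
  · simp [hb]

/-- Two joint actions `A`, `B` on weighted resources such that each player, moving in turn, weakly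
prefers her action in `A` to her action in `B` yield a game with a one-round walk ending in `A`. -/
lemma exists_game_walk {κ : Type*} [Fintype κ] [DecidableEq κ] (w u : ℕ → ℝ) (hu : Monotone u)
    (hw : ∀ k, 0 ≤ w k) {N : ℕ} (hN : 0 < N) (m : κ → ℕ) (A B : Fin N → Finset κ)
    (h : ∀ i, ∑ x ∈ B i, (m x : ℝ) * (u (loadBefore A i x + 1) - u (loadBefore A i x)) ≤
      ∑ x ∈ A i, (m x : ℝ) * (u (loadBefore A i x + 1) - u (loadBefore A i x)))
    (hB : 0 < ∑ x, (m x : ℝ) * w (load B x)) :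
    ∃ (G : ResGame) (traj : ℕ → Fin G.n → Finset (Fin G.d)),
      (∀ r, G.w r = w ∧ G.u r = u) ∧ G.IsWalk (1 * G.n) traj ∧
      G.eff (traj (1 * G.n)) ≤
        (∑ x, (m x : ℝ) * w (load A x)) / ∑ x, (m x : ℝ) * w (load B x) := by
  classical
  let e := Fintype.equivFin (Σ x : κ, Fin (m x))
  let lift : Finset κ → Finset (Fin (Fintype.card (Σ x : κ, Fin (m x)))) :=
    fun S => Finset.univ.filter (fun r => (e.symm r).1 ∈ S)
  have hlift_empty : lift ∅ = ∅ := by simp [lift]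
  have sum_eq (g : κ → ℝ) : ∑ r, g (e.symm r).1 = ∑ x, (m x : ℝ) * g x := by
    rw [Equiv.sum_comp e.symm (fun y => g y.1), Fintype.sum_sigma]
    simp
  let G : ResGame :=
    { n := N
      npos := hN
      d := Fintype.card (Σ x : κ, Fin (m x))
      actions := fun i => {∅, lift (A i), lift (B i)}
      empty_mem := by simp
      w := fun _ => w
      u := fun _ => u }
  have cnt_eq (S : Fin N → Finset κ) (r : Fin G.d) :
      G.cnt (fun i => lift (S i)) r = load S (e.symm r).1 := by
    simp only [ResGame.cnt, load]
    congr 1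
    ext i
    simp [lift]
  have hW (S : Fin N → Finset κ) :
      G.W (fun i => lift (S i)) = ∑ x, (m x : ℝ) * w (load S x) := by
    rw [← sum_eq (fun x => w (load S x))]
    exact Finset.sum_congr rfl fun r _ => by rw [cnt_eq]
  have hU (S : Fin N → Finset κ) :
      G.U (fun i => lift (S i)) = ∑ x, (m x : ℝ) * u (load S x) := by
    rw [← sum_eq (fun x => u (load S x))]
    exact Finset.sum_congr rfl fun r _ => by rw [cnt_eq]
  let traj : ℕ → Fin N → Finset (Fin G.d) :=
    fun t i => lift (if i.val < t then A i else ∅)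
  have hupd (i : Fin N) (b : Finset κ) :
      G.U (Function.update (traj i.val) i (lift b)) =
        ∑ x, (m x : ℝ) * u (loadBefore A i x) +
          ∑ x ∈ b, (m x : ℝ) * (u (loadBefore A i x + 1) - u (loadBefore A i x)) := by
    have : Function.update (traj i.val) i (lift b) = fun j => lift
        (Function.update (fun j : Fin N => if j.val < i.val then A j else ∅) i b j) := by
      funext j
      rcases eq_or_ne j i with rfl | hj
      · simp
      · simp [Function.update_of_ne hj, traj]
    rw [this, hU, ← Fintype.sum_ite_mem b, ← Finset.sum_add_distrib]
    refine Finset.sum_congr rfl fun x _ => ?_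
    rw [load_update_truncated]
    split_ifs
    · ring
    · simp
  have hstep (t : ℕ) (ht : t < N) : G.Step traj t := by
    have hp : G.player t = (⟨t, ht⟩ : Fin N) := Fin.ext (Nat.mod_eq_of_lt ht)
    have hcur : traj (t + 1) ⟨t, ht⟩ = lift (A ⟨t, ht⟩) := by simp [traj]
    unfold ResGame.Step
    rw [hp]
    refine ⟨⟨?_, ?_⟩, ?_⟩
    · rw [hcur]
      simp [G]
    · intro b' hb'
      rw [hcur, hupd ⟨t, ht⟩]
      have hb' : b' = ∅ ∨ b' = lift (A ⟨t, ht⟩) ∨ b' = lift (B ⟨t, ht⟩) := by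
        simpa [G] using hb'
      rcases hb' with rfl | rfl | rfl
      · rw [← hlift_empty, hupd ⟨t, ht⟩]
        rw [Finset.sum_empty]
        refine add_le_add_right ?_ _
        exact Finset.sum_nonneg fun x _ =>
          mul_nonneg (Nat.cast_nonneg _) (sub_nonneg.2 (hu (Nat.le_succ _)))
      · rw [hupd ⟨t, ht⟩]
      · rw [hupd ⟨t, ht⟩]
        exact add_le_add_right (h _) _
    · intro i hi
      have : i.val ≠ t := fun hit => hi (Fin.ext hit)
      have hiff : i.val < t + 1 ↔ i.val < t := by omega
      simp only [traj, hiff]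
  refine ⟨G, traj, fun r => ⟨rfl, rfl⟩, ⟨?_, ?_⟩, ?_⟩
  · funext i
    simp [traj, lift]
  · intro t ht
    exact hstep t (by simpa [G] using ht)
  · have hend : traj (1 * G.n) = fun i => lift (A i) := by
      funext i
      have : i.val < 1 * G.n := (one_mul G.n).symm ▸ i.isLt
      simp only [traj, if_pos this]
    have hbdd : BddAbove {x | ∃ a, G.Valid a ∧ x = G.W a} :=
      ((Set.finite_range G.W).subset (by rintro _ ⟨a, -, rfl⟩; exact ⟨a, rfl⟩)).bddAbove
    have hmax : G.W (fun i => lift (B i)) ≤ G.maxW :=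
      le_csSup hbdd ⟨_, fun i => by simp [G], rfl⟩
    unfold ResGame.eff
    rw [hend, ← hW, ← hW]
    rw [← hW] at hB
    refine div_le_div_of_nonneg_left ?_ hB hmax
    exact Finset.sum_nonneg fun r _ => hw _

lemma sInf_le_of_mem_of_nonneg {S : Set ℝ} {x y : ℝ} (hx : x ∈ S) (hxy : x ≤ y) (hy : 0 ≤ y) :
    sInf S ≤ y := by
  by_cases hS : BddBelow S
  · exact (csInf_le hS hx).trans hxy
  · rwa [Real.sInf_of_not_bddBelow hS]

lemma fRule_nonneg {c : ℝ} (hc : c ≤ 1) : ∀ j, 0 ≤ fRule c j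
  | 0 => by simp [fRule]
  | 1 => by simp [fRule]
  | j + 2 => by
    rw [fRule]
    exact le_max_of_le_right (by linarith)

lemma uRule_succ (c : ℝ) (j : ℕ) : uRule c (j + 1) = uRule c j + fRule c (j + 1) := by
  unfold uRule
  rw [Finset.sum_Icc_succ_top (by omega)]

lemma uRule_monotone {c : ℝ} (hc : c ≤ 1) : Monotone (uRule c) :=
  monotone_nat_of_le_succ fun j => by
    rw [uRule_succ]
    linarith [fRule_nonneg hc (j + 1)]

lemma bentW_zero (c : ℝ) : bentW c 0 = 0 := by simp [bentW]

lemma bentW_succ (c : ℝ) (j : ℕ) : bentW c (j + 1) = (1 - c) * (j + 1) + c := by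
  have : min ((j + 1 : ℕ) : ℝ) 1 = 1 := min_eq_right (by simp)
  rw [bentW, this]
  push_cast
  ring

lemma bentW_monotone {c : ℝ} (hc : c ∈ Set.Icc (0 : ℝ) 1) : Monotone (bentW c) := by
  intro i j hij
  have h1 : 0 ≤ 1 - c := by linarith [hc.2]
  have h0 := hc.1
  have : (i : ℝ) ≤ j := by exact_mod_cast hij
  unfold bentW
  gcongr

lemma fRule_two {c : ℝ} (hc : c ∈ Set.Icc (0 : ℝ) 1) :
    fRule c 2 = 2 - Real.exp 1 / (Real.exp 1 - c) := by
  obtain ⟨h0, h1⟩ := hc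
  have he := Real.exp_one_gt_d9
  have hec : 0 < Real.exp 1 - c := by linarith
  have hρ : (1 - c / Real.exp 1)⁻¹ = Real.exp 1 / (Real.exp 1 - c) := by
    rw [one_sub_div (by positivity), inv_div]
  have hle : Real.exp 1 / (Real.exp 1 - c) ≤ 1 + c := by
    rw [div_le_iff₀ hec]
    nlinarith
  have hw : bentW c (0 + 1) = 1 := by rw [bentW_succ]; norm_num
  change fRule c (0 + 2) = _
  rw [fRule, hρ]
  have h1' : fRule c (0 + 1) = 1 := rfl
  rw [hw, h1', max_eq_left (by push_cast; linarith)]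
  push_cast
  ring

lemma fRule_three {c : ℝ} (hc : c ∈ Set.Icc (0 : ℝ) 1) :
    fRule c 3 = 5 - (4 - c) * (Real.exp 1 / (Real.exp 1 - c)) := by
  have h2 := fRule_two hc
  obtain ⟨h0, h1⟩ := hc
  have he := Real.exp_one_gt_d9
  have hec : 0 < Real.exp 1 - c := by linarith
  have hρ : (1 - c / Real.exp 1)⁻¹ = Real.exp 1 / (Real.exp 1 - c) := by
    rw [one_sub_div (by positivity), inv_div]
  have hle : (4 - c) * (Real.exp 1 / (Real.exp 1 - c)) ≤ 4 + c := by
    rw [← mul_div_assoc, div_le_iff₀ hec]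
    nlinarith
  have hw : bentW c (1 + 1) = 2 - c := by rw [bentW_succ]; push_cast; ring
  change fRule c (1 + 2) = _
  rw [fRule, hρ]
  have h2' : fRule c (1 + 1) = 2 - Real.exp 1 / (Real.exp 1 - c) := h2
  rw [hw, h2', max_eq_left (by push_cast; linarith)]
  push_cast
  ring

/-- The walk's action of player `i` in the chain game: shared resources `i + 1` and `i + 2`. -/
def chainWalk (N : ℕ) (i : Fin N) : Finset (Fin (N + 2) ⊕ Fin N) :=
  {Sum.inl ⟨i + 1, by omega⟩, Sum.inl ⟨i + 2, by omega⟩}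

/-- The alternative action of player `i` in the chain game: shared resource `i` and the private
resource `i`. -/
def chainAlt (N : ℕ) (i : Fin N) : Finset (Fin (N + 2) ⊕ Fin N) :=
  {Sum.inl ⟨i, by omega⟩, Sum.inr i}

/-- Multiplicities in the chain game: `M` copies of each shared resource from the third on, and
`F` copies of each private resource except the first one. -/
def chainMult (N M F : ℕ) : Fin (N + 2) ⊕ Fin N → ℕ
  | Sum.inl s => if s.val < 2 then 0 else M
  | Sum.inr i => if i.val = 0 then 0 else F

lemma loadBefore_chainWalk_inr (N : ℕ) (i j : Fin N) :
    loadBefore (chainWalk N) i (Sum.inr j) = 0 := by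
  simp [loadBefore, chainWalk]

lemma load_chainWalk_inr (N : ℕ) (j : Fin N) : load (chainWalk N) (Sum.inr j) = 0 := by
  simp [load, chainWalk]

lemma loadBefore_chainWalk_first (N : ℕ) (i : Fin N) (h : i.val + 2 < N + 2) :
    loadBefore (chainWalk N) i (Sum.inl ⟨i + 2, h⟩) = 0 := by
  simp only [loadBefore, Finset.card_eq_zero, Finset.filter_eq_empty_iff]
  intro j _ hj
  simp only [chainWalk, Finset.mem_insert, Finset.mem_singleton, Sum.inl.injEq, Fin.mk.injEq,
    Fin.lt_def] at hj
  omega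

lemma loadBefore_chainWalk_second (N : ℕ) (i : Fin N) (hi : 1 ≤ i.val) (h : i.val + 1 < N + 2) :
    loadBefore (chainWalk N) i (Sum.inl ⟨i + 1, h⟩) = 1 := by
  rw [loadBefore, Finset.card_eq_one]
  refine ⟨⟨i - 1, by omega⟩, ?_⟩
  ext j
  simp only [chainWalk, Finset.mem_filter, Finset.mem_univ, true_and, Finset.mem_insert,
    Finset.mem_singleton, Sum.inl.injEq, Fin.lt_def, Fin.ext_iff]
  omega

lemma loadBefore_chainWalk_third (N : ℕ) (i : Fin N) (hi : 2 ≤ i.val) (h : i.val < N + 2) :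
    loadBefore (chainWalk N) i (Sum.inl ⟨i, h⟩) = 2 := by
  rw [loadBefore, Finset.card_eq_two]
  refine ⟨⟨i - 1, by omega⟩, ⟨i - 2, by omega⟩, by simp only [ne_eq, Fin.mk.injEq]; omega, ?_⟩
  ext j
  simp only [chainWalk, Finset.mem_filter, Finset.mem_univ, true_and, Finset.mem_insert,
    Finset.mem_singleton, Sum.inl.injEq, Fin.lt_def, Fin.ext_iff]
  omega

lemma load_chainWalk_inl_le (N : ℕ) (s : Fin (N + 2)) :
    load (chainWalk N) (Sum.inl s) ≤ 2 := by
  rw [load, ← Finset.card_image_of_injective _ Fin.val_injective]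
  refine (Finset.card_le_card (t := {s.val - 1, s.val - 2}) ?_).trans Finset.card_le_two
  intro k
  simp only [chainWalk, Finset.mem_image, Finset.mem_filter, Finset.mem_univ, true_and,
    Finset.mem_insert, Finset.mem_singleton, Sum.inl.injEq, Fin.ext_iff]
  rintro ⟨j, hj, rfl⟩
  omega

lemma one_le_load_chainAlt_inl (N : ℕ) (i : Fin N) (h : i.val < N + 2) :
    1 ≤ load (chainAlt N) (Sum.inl ⟨i, h⟩) :=
  Finset.card_pos.2 ⟨i, by simp [chainAlt]⟩

lemma one_le_load_chainAlt_inr (N : ℕ) (i : Fin N) :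
    1 ≤ load (chainAlt N) (Sum.inr i) :=
  Finset.card_pos.2 ⟨i, by simp [chainAlt]⟩

lemma chainWalk_preferred {c : ℝ} (hc : c ≤ 1) (N M F : ℕ)
    (hF : (F : ℝ) ≤ M * (1 + fRule c 2 - fRule c 3)) (i : Fin N) :
    ∑ x ∈ chainAlt N i, (chainMult N M F x : ℝ) *
        (uRule c (loadBefore (chainWalk N) i x + 1) - uRule c (loadBefore (chainWalk N) i x)) ≤
      ∑ x ∈ chainWalk N i, (chainMult N M F x : ℝ) *
        (uRule c (loadBefore (chainWalk N) i x + 1) - uRule c (loadBefore (chainWalk N) i x)) := by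
  have hM : (0 : ℝ) ≤ M := M.cast_nonneg
  have hf1 : fRule c 1 = 1 := rfl
  have hf3 := fRule_nonneg hc 3
  simp only [uRule_succ, add_sub_cancel_left]
  rw [chainAlt, chainWalk, Finset.sum_pair (by simp), Finset.sum_pair (by simp),
    loadBefore_chainWalk_first, loadBefore_chainWalk_inr]
  rcases Nat.lt_or_ge i.val 1 with h0 | h1
  · have : i.val = 0 := by omega
    simp [chainMult, this, hf1]
  rw [loadBefore_chainWalk_second N i h1]
  have hne : i.val ≠ 0 := by omega
  have hnl : ¬ i.val + 1 < 2 := by omega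
  rcases Nat.lt_or_ge i.val 2 with h2 | h2
  · simp only [chainMult, h2, hne, hnl, if_true, if_false, hf1, zero_add,
      Nat.cast_zero, zero_mul, mul_one]
    have : ¬ i.val + 2 < 2 := by omega
    simp only [this, if_false]
    nlinarith [mul_nonneg hM hf3]
  · rw [loadBefore_chainWalk_third N i h2]
    have h2' : ¬ i.val < 2 := by omega
    have : ¬ i.val + 2 < 2 := by omega
    simp only [chainMult, h2', hne, hnl, this, if_false, hf1, zero_add, mul_one, Nat.reduceAdd]
    linarith

lemma welfare_chainWalk_le {c : ℝ} (hc : c ∈ Set.Icc (0 : ℝ) 1) (N M F : ℕ) :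
    ∑ x, (chainMult N M F x : ℝ) * bentW c (load (chainWalk N) x) ≤
      (N + 2) * (M * (2 - c)) := by
  have hw2 : bentW c 2 = 2 - c := by
    rw [show (2 : ℕ) = 1 + 1 from rfl, bentW_succ]; push_cast; ring
  have h2c : 0 ≤ 2 - c := by linarith [hc.2]
  rw [Fintype.sum_sum_type]
  simp only [load_chainWalk_inr, bentW_zero, mul_zero, Finset.sum_const_zero, add_zero]
  refine (Finset.sum_le_card_nsmul _ _ (M * (2 - c)) fun s _ => ?_).trans (by simp)
  have h1 : (chainMult N M F (Sum.inl s) : ℝ) ≤ M := by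
    simp only [chainMult]
    split_ifs <;> simp
  have h3 := bentW_monotone hc (load_chainWalk_inl_le N s)
  rw [hw2] at h3
  exact mul_le_mul_of_nonneg h1 h3 (Nat.cast_nonneg _) h2c

lemma le_welfare_chainAlt {c : ℝ} (hc : c ∈ Set.Icc (0 : ℝ) 1) (n M F : ℕ) :
    (n : ℝ) * (M + F) ≤
      ∑ x, (chainMult (n + 2) M F x : ℝ) * bentW c (load (chainAlt (n + 2)) x) := by
  have hw1 : bentW c 1 = 1 := by
    rw [show (1 : ℕ) = 0 + 1 from rfl, bentW_succ]; norm_num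
  have hnn (k : ℕ) : 0 ≤ bentW c k := by
    have := bentW_monotone hc (Nat.zero_le k)
    rwa [bentW_zero] at this
  have hge {k : ℕ} (hk : 1 ≤ k) : 1 ≤ bentW c k := hw1 ▸ bentW_monotone hc hk
  let φ : Fin n ⊕ Fin n → Fin (n + 2 + 2) ⊕ Fin (n + 2) :=
    Sum.map (fun i => ⟨i + 2, by omega⟩) (fun i => ⟨i + 2, by omega⟩)
  have hφ : Function.Injective φ := by
    refine Sum.map_injective.2 ⟨fun i j hij => ?_, fun i j hij => ?_⟩ <;>
    · simp only [Fin.mk.injEq] at hij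
      exact Fin.ext (by omega)
  calc (n : ℝ) * (M + F)
      = ∑ y : Fin n ⊕ Fin n, (chainMult (n + 2) M F (φ y) : ℝ) := by
        rw [Fintype.sum_sum_type]
        simp [φ, chainMult]
        ring
    _ ≤ ∑ y, (chainMult (n + 2) M F (φ y) : ℝ) * bentW c (load (chainAlt (n + 2)) (φ y)) := by
        refine Finset.sum_le_sum fun y _ => le_mul_of_one_le_right (Nat.cast_nonneg _) (hge ?_)
        rcases y with i | i
        · exact one_le_load_chainAlt_inl (n + 2) ⟨i + 2, by omega⟩ (by simp; omega)
        · exact one_le_load_chainAlt_inr (n + 2) _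
    _ = ∑ x ∈ Finset.univ.image φ,
          (chainMult (n + 2) M F x : ℝ) * bentW c (load (chainAlt (n + 2)) x) :=
        (Finset.sum_image (f := fun x =>
          (chainMult (n + 2) M F x : ℝ) * bentW c (load (chainAlt (n + 2)) x))
          fun _ _ _ _ h => hφ h).symm
    _ ≤ _ := Finset.sum_le_univ_sum_of_nonneg fun x => mul_nonneg (Nat.cast_nonneg _) (hnn _)

/-- For each `n ≥ 2` the chain game with `n + 2` players and `n` copies of each shared resource. -/
lemma exists_chain_game {c : ℝ} (hc : c ∈ Set.Icc (0 : ℝ) 1)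
    (hT : 0 ≤ 1 + fRule c 2 - fRule c 3) {n : ℕ} (hn : 2 ≤ n) :
    ∃ (G : ResGame) (traj : ℕ → Fin G.n → Finset (Fin G.d)),
      (∀ r, G.w r = bentW c ∧ G.u r = uRule c) ∧ G.IsWalk (1 * G.n) traj ∧
      G.eff (traj (1 * G.n)) ≤
        (1 + 4 / n) * (2 - c) / (2 + fRule c 2 - fRule c 3 - 1 / n) := by
  set T := 1 + fRule c 2 - fRule c 3 with hTdef
  have hn' : (2 : ℝ) ≤ n := by exact_mod_cast hn
  have hF1 : (⌊n * T⌋₊ : ℝ) ≤ n * T := Nat.floor_le (by positivity)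
  have hF2 : (n : ℝ) * T - 1 < ⌊n * T⌋₊ := by linarith [Nat.lt_floor_add_one ((n : ℝ) * T)]
  have hA := welfare_chainWalk_le hc (n + 2) n ⌊n * T⌋₊
  have hB := le_welfare_chainAlt hc n n ⌊n * T⌋₊
  have hpos : 0 < (n : ℝ) * (n + (n * T - 1)) := by
    have : 0 ≤ n * T := by positivity
    exact mul_pos (by linarith) (by linarith)
  have hB' : (n : ℝ) * (n + (n * T - 1)) ≤ _ := le_trans (by gcongr) hB
  obtain ⟨G, traj, hG, hwalk, heff⟩ := exists_game_walk (bentW c) (uRule c)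
    (uRule_monotone hc.2) (fun k => by simpa [bentW_zero] using bentW_monotone hc (Nat.zero_le k))
    (Nat.succ_pos _) (chainMult (n + 2) n ⌊n * T⌋₊) (chainWalk (n + 2)) (chainAlt (n + 2))
    (chainWalk_preferred hc.2 (n + 2) n ⌊n * T⌋₊ hF1) (hpos.trans_le hB')
  refine ⟨G, traj, hG, hwalk, heff.trans ?_⟩
  have h2c : 0 ≤ 2 - c := by linarith [hc.2]
  refine (div_le_div₀ (by positivity) hA hpos hB').trans_eq ?_
  have hd : 2 + fRule c 2 - fRule c 3 - 1 / n = (n + (n * T - 1)) / n := by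
    rw [hTdef]
    field_simp
    ring
  have hne : (n : ℝ) + (n * T - 1) ≠ 0 := (pos_of_mul_pos_right hpos (by linarith)).ne'
  rw [hd]
  push_cast
  field_simp
  ring

lemma exists_game_eff_le {c : ℝ} (hc : c ∈ Set.Icc (0 : ℝ) 1) {ε : ℝ} (hε : 0 < ε) :
    ∃ (G : ResGame) (traj : ℕ → Fin G.n → Finset (Fin G.d)),
      (∀ r, G.w r = bentW c ∧ G.u r = uRule c) ∧ G.IsWalk (1 * G.n) traj ∧
      G.eff (traj (1 * G.n)) ≤ 1 + (c - 3) * c / ((2 - c) * Real.exp 1 + c) + ε := by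
  have h0 := hc.1
  have h1 := hc.2
  have he := Real.exp_one_gt_d9
  have hec : 0 < Real.exp 1 - c := by linarith
  have hden : 0 < (2 - c) * Real.exp 1 + c :=
    add_pos_of_pos_of_nonneg (mul_pos (by linarith) (by linarith)) h0
  have hS : 2 + fRule c 2 - fRule c 3 = ((2 - c) * Real.exp 1 + c) / (Real.exp 1 - c) := by
    rw [fRule_two hc, fRule_three hc]
    field_simp
    ring
  have hT : 0 ≤ 1 + fRule c 2 - fRule c 3 := by
    have : 1 ≤ ((2 - c) * Real.exp 1 + c) / (Real.exp 1 - c) := by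
      rw [one_le_div hec]
      nlinarith
    linarith
  have hlim : Filter.Tendsto
      (fun n : ℕ => (1 + 4 / (n : ℝ)) * (2 - c) / (2 + fRule c 2 - fRule c 3 - 1 / n))
      Filter.atTop (nhds ((1 + 0) * (2 - c) / (2 + fRule c 2 - fRule c 3 - 0))) := by
    refine Filter.Tendsto.div ?_ ?_ (by linarith)
    · exact ((tendsto_const_div_atTop_nhds_zero_nat 4).const_add 1).mul_const _
    · exact (tendsto_const_div_atTop_nhds_zero_nat 1).const_sub _
  have hval : (1 + 0) * (2 - c) / (2 + fRule c 2 - fRule c 3 - 0) =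
      1 + (c - 3) * c / ((2 - c) * Real.exp 1 + c) := by
    rw [sub_zero, hS]
    field_simp
    ring
  rw [hval] at hlim
  obtain ⟨n, hlt, hn⟩ := ((hlim.eventually_lt_const (lt_add_of_pos_right _ hε)).and
    (Filter.eventually_ge_atTop 2)).exists
  obtain ⟨G, traj, hG, hwalk, heff⟩ := exists_chain_game hc hT hn
  exact ⟨G, traj, hG, hwalk, heff.trans hlt.le⟩

/-- The asymptotically optimal design for the bent welfare rule
has one-round guarantee at most `1 + (c-3)c/((2-c)e + c)`: for every `ε > 0` there
is a game with these welfare/distribution rules and a one-round walk from the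
empty joint action whose final joint action has efficiency at most the bound plus `ε`. -/
theorem stmt7 (c : ℝ) (hc : c ∈ Set.Icc (0 : ℝ) 1) :
    pobWU (bentW c) (uRule c) 1 ≤ 1 + (c - 3) * c / ((2 - c) * Real.exp 1 + c) ∧
    ∀ ε > (0 : ℝ), ∃ (G : ResGame) (traj : ℕ → Fin G.n → Finset (Fin G.d)),
      (∀ r, G.w r = bentW c ∧ G.u r = uRule c) ∧ G.IsWalk (1 * G.n) traj ∧
      G.eff (traj (1 * G.n)) ≤ 1 + (c - 3) * c / ((2 - c) * Real.exp 1 + c) + ε := by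
  have hbound : 0 ≤ 1 + (c - 3) * c / ((2 - c) * Real.exp 1 + c) := by
    have he := Real.exp_one_gt_d9
    have hden : 0 < (2 - c) * Real.exp 1 + c :=
      add_pos_of_pos_of_nonneg (mul_pos (by linarith [hc.2]) (by linarith)) hc.1
    rw [one_add_div hden.ne']
    refine div_nonneg ?_ hden.le
    nlinarith [mul_nonneg (sub_nonneg.2 hc.2) (sub_nonneg.2 hc.2), hc.1, hc.2]
  refine ⟨le_of_forall_pos_le_add fun ε hε => ?_, fun ε hε => exists_game_eff_le hc hε⟩
  obtain ⟨G, traj, hG, hwalk, heff⟩ := exists_game_eff_le hc hε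
  have hnn := add_nonneg hbound hε.le
  exact sInf_le_of_mem_of_nonneg ⟨G, hG, rfl⟩
    (sInf_le_of_mem_of_nonneg ⟨traj, hwalk, rfl⟩ heff hnn) hnn
end

section
/- Let c ∈ [0,1], e = exp(1), ρ = (1 − c/e)^{−1}, and let w(j) = (1−c)j + c·min(j,1) (so w(1) = 1 and w(2) = 2 − c). Define f(1) = 1, f(2) = max{ f(1) − ρ·w(1) + 1, 1 − c } and f(3) = max{ 2·f(2) − ρ·w(2) + 1, 1 − c }. Then (1 + f(1) + f(2) − f(3)) / w(2) ≥ ((2−c)e + c) / ((2−c)(e−c)). -/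
theorem fRule_add_two (c : ℝ) (j : ℕ) : fRule c (j + 2) = max ((j + 1 : ℝ) * fRule c (j + 1) -
    (1 - c / Real.exp 1)⁻¹ * bentW c (j + 1) + 1) (1 - c) := by
  rw [fRule]

/-- With `f(1) = 1`, `f(2) = max{f(1) − ρ·w(1) + 1, 1−c}` and
`f(3) = max{2·f(2) − ρ·w(2) + 1, 1−c}`, one has
`(1 + f(1) + f(2) − f(3)) / w(2) ≥ ((2−c)e + c) / ((2−c)(e−c))`. -/
theorem stmt8 (c : ℝ) (hc : c ∈ Set.Icc (0 : ℝ) 1) :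
    ((2 - c) * Real.exp 1 + c) / ((2 - c) * (Real.exp 1 - c)) ≤
      (1 + fRule c 1 + fRule c 2 - fRule c 3) / bentW c 2 := by
  obtain ⟨h0, h1⟩ := hc
  have he : (2.7 : ℝ) < Real.exp 1 := by linarith [Real.exp_one_gt_d9]
  have hw1 : bentW c 1 = 1 := by simp [bentW]
  have hw2 : bentW c 2 = 2 - c := by
    norm_num [bentW]
    ring
  have hd : 0 < Real.exp 1 - c := by linarith
  obtain ⟨t, ht⟩ : ∃ t, t = c / (Real.exp 1 - c) := ⟨_, rfl⟩
  have htc : t * (Real.exp 1 - c) = c := by rw [ht, div_mul_cancel₀ _ hd.ne']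
  have ht0 : 0 ≤ t := ht ▸ div_nonneg h0 hd.le
  have hρ : (1 - c / Real.exp 1)⁻¹ = 1 + t := by
    have : Real.exp 1 ≠ 0 := (Real.exp_pos 1).ne'
    have : Real.exp 1 - c ≠ 0 := hd.ne'
    rw [ht]
    field_simp
    ring
  have hf1 : fRule c 1 = 1 := by simp [fRule]
  have hf2 : fRule c 2 = 1 - t := by
    have h : fRule c 2 = max (((0 : ℕ) + 1 : ℝ) * fRule c 1 -
        (1 - c / Real.exp 1)⁻¹ * bentW c 1 + 1) (1 - c) := fRule_add_two c 0
    rw [h, hρ, hw1, hf1, max_eq_left]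
    · push_cast
      ring
    · push_cast
      nlinarith
  have hf3 : fRule c 3 = max (((1 : ℕ) + 1 : ℝ) * fRule c 2 -
      (1 - c / Real.exp 1)⁻¹ * bentW c 2 + 1) (1 - c) := fRule_add_two c 1
  have hle : fRule c 3 ≤ 1 + c - 4 * t + t * c := by
    rw [hf3, hρ, hw2, hf2]
    refine max_le (le_of_eq ?_) ?_
    · push_cast
      ring
    · nlinarith
  have hlhs : ((2 - c) * Real.exp 1 + c) / ((2 - c) * (Real.exp 1 - c)) =
      ((1 + t) * (2 - c) + t) / (2 - c) := by
    have : 2 - c ≠ 0 := by linarith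
    rw [div_eq_div_iff (mul_ne_zero this hd.ne') this]
    linear_combination (-(2 - c) * (3 - c)) * htc
  rw [hlhs, hw2, hf1, hf2]
  exact div_le_div_of_nonneg_right (by linarith) (by linarith)
end

section
/- Let 𝒲 be the set of all welfare rules (nondecreasing, concave, w(0)=0, w(1)>0) with curvature at most 1. For each integer b ≥ 1 let ρ_b = (1 − b^b e^{−b}/b!)^{−1} and let f_b be defined by f_b(1) = 1 and f_b(j+1) = (1/b)(j·f_b(j) − ρ_b·min(j,b)) + 1. Let Γ*∞ be any utility design that assigns to each bent welfare rule w(j) = min(j,b) the distribution rule u_b(j) = Σ_{i=1}^{j} f_b(i). Then pob(𝒲, Γ*∞; 1) = 0: for every ε > 0 there exists a game G ∈ 𝒢_{𝒲,Γ*∞} and a one-round walk from the empty joint action whose final joint action has efficiency less than ε. -/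
/-- `ρ_b = (1 − b^b e^{−b}/b!)⁻¹`. -/
noncomputable def rhoB (b : ℕ) : ℝ :=
  (1 - (b : ℝ) ^ b * Real.exp (-(b : ℝ)) / (Nat.factorial b : ℝ))⁻¹

/-- The asymptotically optimal utility rule for the bent welfare rule
`w(j) = min(j,b)` : `f_b(1) = 1`, `f_b(j+1) = (1/b)(j·f_b(j) − ρ_b·min(j,b)) + 1`. -/
noncomputable def fB (b : ℕ) : ℕ → ℝ
  | 0 => 0
  | 1 => 1
  | (j + 2) => (1 / (b : ℝ)) * ((j + 1 : ℝ) * fB b (j + 1) -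
      rhoB b * ((min (j + 1) b : ℕ) : ℝ)) + 1

/-- The induced distribution rule `u_b(j) = Σ_{i=1}^{j} f_b(i)`. -/
noncomputable def uB (b : ℕ) (j : ℕ) : ℝ := ∑ i ∈ Finset.Icc 1 j, fB b i

/-- The bent welfare rule of curvature `1` with bend at `b`: `w(j) = min(j,b)`. -/
def bentB (b : ℕ) : ℕ → ℝ := fun j => ((min j b : ℕ) : ℝ)

section OneRoundWalk

open Finset

lemma bentB_one_mem_curvW : bentB 1 ∈ curvW 1 := by
  have h_succ : ∀ j, bentB 1 (j + 1) = 1 := fun j => by simp [bentB]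
  have h_zero : bentB 1 0 = 0 := by simp [bentB]
  refine ⟨⟨h_zero, ?_, ?_, ?_⟩, 0, ?_, by simp⟩
  · rw [h_succ 0]; exact one_pos
  · intro i j hij
    simp only [bentB]
    exact_mod_cast min_le_min_right 1 hij
  · rintro (_ | j)
    · rw [h_succ 1, h_succ 0, h_zero]; norm_num
    · rw [h_succ (j + 2), h_succ (j + 1), h_succ j]
  · refine tendsto_const_nhds.congr' ?_
    filter_upwards [Filter.eventually_ge_atTop 1] with n hn
    obtain ⟨m, rfl⟩ := Nat.exists_eq_add_of_le' hn
    rw [h_succ (m + 1), h_succ m, sub_self]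

lemma three_halves_le_rhoB_one : 3 / 2 ≤ rhoB 1 := by
  have h_lower : 1 / 3 ≤ Real.exp (-1) := by
    rw [Real.exp_neg, ← one_div]
    exact one_div_le_one_div_of_le (Real.exp_pos 1) (by linarith [Real.exp_one_lt_d9])
  have h_upper : Real.exp (-1) < 1 := by rw [Real.exp_lt_one_iff]; norm_num
  simp only [rhoB, Nat.cast_one, one_pow, one_mul, Nat.factorial_one, div_one]
  rw [le_inv_comm₀ (by norm_num) (by linarith)]
  linarith

lemma uB_succ (b j : ℕ) : uB b (j + 1) = uB b j + fB b (j + 1) :=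
  Finset.sum_Icc_succ_top (by omega) _

/-- The marginals of a nondecreasing `u_1` decay no faster than harmonically. -/
lemma one_le_two_mul_fB_one (h : Monotone (uB 1)) (j : ℕ) :
    1 ≤ 2 * ((j + 1 : ℝ) * fB 1 (j + 1)) := by
  have h_nonneg : 0 ≤ fB 1 (j + 2) := by
    have h_le := h (Nat.le_succ (j + 1))
    rw [Nat.succ_eq_add_one, uB_succ 1 (j + 1)] at h_le
    linarith
  have h_rec : fB 1 (j + 2) = (j + 1 : ℝ) * fB 1 (j + 1) - rhoB 1 + 1 := by
    rw [fB]; simp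
  linarith [three_halves_le_rhoB_one]

namespace ResGame

lemma cnt_update_of_eq_empty (G : ResGame) (a : Fin G.n → Finset (Fin G.d)) (i : Fin G.n)
    (hi : a i = ∅) (b : Finset (Fin G.d)) (r : Fin G.d) :
    G.cnt (Function.update a i b) r = G.cnt a r + if r ∈ b then 1 else 0 := by
  unfold cnt
  split_ifs with hr
  · rw [← Finset.card_insert_of_notMem (a := i) (by simp [hi])]
    congr 1
    ext k
    by_cases hk : k = i
    · subst hk; simp [hr]
    · simp [hk]
  · rw [add_zero]
    congr 1
    ext k
    by_cases hk : k = i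
    · subst hk; simp [hr, hi]
    · simp [hk]

section Class

variable {Γ : (ℕ → ℝ) → (ℕ → ℝ)} {c : ℝ} {G : ResGame}

lemma W_nonneg (hG : InClass (curvW c) Γ G) (a : Fin G.n → Finset (Fin G.d)) : 0 ≤ G.W a := by
  refine Finset.sum_nonneg fun r _ => ?_
  obtain ⟨h_zero, -, h_mono, -⟩ := (hG r).1.1
  exact h_zero ▸ h_mono (Nat.zero_le _)

lemma eff_nonneg (hG : InClass (curvW c) Γ G) (a : Fin G.n → Finset (Fin G.d)) :
    0 ≤ G.eff a := by
  refine div_nonneg (W_nonneg hG a) (Real.sSup_nonneg ?_)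
  rintro _ ⟨a', -, rfl⟩
  exact W_nonneg hG a'

lemma pob_nonneg (hG : InClass (curvW c) Γ G) (k : ℕ) : 0 ≤ G.pob k := by
  refine Real.sInf_nonneg ?_
  rintro _ ⟨traj, -, rfl⟩
  exact eff_nonneg hG _

lemma pob_le_eff (hG : InClass (curvW c) Γ G) {k : ℕ}
    {traj : ℕ → Fin G.n → Finset (Fin G.d)} (h : G.IsWalk (k * G.n) traj) :
    G.pob k ≤ G.eff (traj (k * G.n)) := by
  refine csInf_le ⟨0, ?_⟩ ⟨traj, h, rfl⟩
  rintro _ ⟨traj', -, rfl⟩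
  exact eff_nonneg hG _

end Class

lemma le_maxW (G : ResGame) {a : Fin G.n → Finset (Fin G.d)} (ha : G.Valid a) :
    G.W a ≤ G.maxW :=
  le_csSup (((Set.toFinite {a | G.Valid a}).image G.W).bddAbove.mono
    (by rintro _ ⟨a', ha', rfl⟩; exact ⟨a', ha', rfl⟩)) ⟨a, ha, rfl⟩

end ResGame

/-- The first `p` resources of the `k`-th of `m` rows of `q` resources each. -/
def rowPrefix {m q : ℕ} (k : Fin m) (p : ℕ) : Finset (Fin (m * q)) :=
  {r | (finProdFinEquiv.symm r).1 = k ∧ ((finProdFinEquiv.symm r).2 : ℕ) < p}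

lemma card_rowPrefix {m q : ℕ} (k : Fin m) {p : ℕ} (hp : p ≤ q) :
    #(rowPrefix (q := q) k p) = p := by
  have h_map : rowPrefix (q := q) k p =
      ((univ.filter fun x : Fin q => (x : ℕ) < p).map
        ⟨fun x => (k, x), fun _ _ h => (Prod.mk.inj h).2⟩).map
          finProdFinEquiv.toEmbedding := by
    ext r
    obtain ⟨⟨k', x⟩, rfl⟩ := finProdFinEquiv.surjective r
    simp only [rowPrefix, mem_filter, mem_univ, true_and, Equiv.symm_apply_apply,
      mem_map, Function.Embedding.coeFn_mk]
    constructor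
    · rintro ⟨rfl, h⟩; exact ⟨(k', x), ⟨x, h, rfl⟩, rfl⟩
    · rintro ⟨_, ⟨y, h, rfl⟩, h'⟩
      obtain ⟨rfl, rfl⟩ := Prod.mk.inj (finProdFinEquiv.injective h')
      exact ⟨rfl, h⟩
  rw [h_map, card_map, card_map, Fin.card_filter_val_lt, min_eq_right hp]

lemma disjoint_rowPrefix {m q : ℕ} {k k' : Fin m} (h : k ≠ k') (p p' : ℕ) :
    Disjoint (rowPrefix (q := q) k p) (rowPrefix k' p') := by
  rw [Finset.disjoint_left]
  intro r hr hr'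
  simp only [rowPrefix, mem_filter] at hr hr'
  exact h (hr.2.1.symm.trans hr'.2.1)

/-- The resources shared by all players of `trapGame`. -/
def sharedSet (n : ℕ) : Finset (Fin ((n + 1) * (2 * n.factorial))) :=
  rowPrefix 0 (2 * n.factorial)

/-- The resources available only to player `i` of `trapGame`. -/
def privateSet (n : ℕ) (i : Fin n) : Finset (Fin ((n + 1) * (2 * n.factorial))) :=
  rowPrefix i.succ (n.factorial / (i + 1))

/-- Each player chooses between a common block of resources and a private block, the sizes of the
private blocks decaying harmonically. -/
noncomputable abbrev trapGame (n : ℕ) (hn : 0 < n) : ResGame where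
  n := n
  npos := hn
  d := (n + 1) * (2 * n.factorial)
  actions i := {∅, sharedSet n, privateSet n i}
  empty_mem i := by simp
  w _ := bentB 1
  u _ := uB 1

/-- The walk of `trapGame` in which every player picks the common block. -/
def trapWalk (n : ℕ) (τ : ℕ) (i : Fin n) : Finset (Fin ((n + 1) * (2 * n.factorial))) :=
  if (i : ℕ) < τ then sharedSet n else ∅

section Trap

variable {n : ℕ}

lemma card_sharedSet : #(sharedSet n) = 2 * n.factorial := card_rowPrefix _ le_rfl

lemma card_privateSet (i : Fin n) : #(privateSet n i) = n.factorial / (i + 1) :=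
  card_rowPrefix _ ((Nat.div_le_self _ _).trans (Nat.le_mul_of_pos_left _ two_pos))

lemma cast_card_privateSet (i : Fin n) :
    (#(privateSet n i) : ℝ) = n.factorial * (1 / ((i : ℕ) + 1 : ℝ)) := by
  rw [card_privateSet, Nat.cast_div (Nat.dvd_factorial (Nat.succ_pos _) i.isLt)
    (by positivity), mul_one_div]
  push_cast
  rfl

lemma disjoint_shared_private (i : Fin n) : Disjoint (sharedSet n) (privateSet n i) :=
  disjoint_rowPrefix (Fin.succ_ne_zero i).symm _ _

lemma disjoint_private_private {i j : Fin n} (h : i ≠ j) :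
    Disjoint (privateSet n i) (privateSet n j) :=
  disjoint_rowPrefix (fun h' => h (Fin.succ_injective _ h')) _ _

variable (hn : 0 < n)

lemma cnt_trapWalk {τ : ℕ} (hτ : τ ≤ n) (r : Fin (trapGame n hn).d) :
    (trapGame n hn).cnt (trapWalk n τ) r = if r ∈ sharedSet n then τ else 0 := by
  change #(univ.filter fun i : Fin n => r ∈ trapWalk n τ i) = _
  split_ifs with hr
  · have h_filter : (univ.filter fun i : Fin n => r ∈ trapWalk n τ i) =
        univ.filter fun i : Fin n => (i : ℕ) < τ := by
      refine Finset.filter_congr fun i _ => ?_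
      by_cases hi : (i : ℕ) < τ <;> simp [trapWalk, hi, hr]
    rw [h_filter, Fin.card_filter_val_lt, min_eq_right hτ]
  · rw [card_eq_zero, filter_eq_empty_iff]
    intro i _
    by_cases hi : (i : ℕ) < τ <;> simp [trapWalk, hi, hr]

lemma sum_ite_sharedSet (x : ℝ) :
    ∑ r : Fin ((n + 1) * (2 * n.factorial)), (if r ∈ sharedSet n then x else 0) =
      2 * n.factorial * x := by
  rw [Finset.sum_ite_mem, univ_inter, sum_const, card_sharedSet, nsmul_eq_mul]
  push_cast
  rfl

lemma W_trapWalk : (trapGame n hn).W (trapWalk n n) = 2 * n.factorial := by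
  have h_term : ∀ r : Fin (trapGame n hn).d,
      bentB 1 ((trapGame n hn).cnt (trapWalk n n) r) =
        if r ∈ sharedSet n then (1 : ℝ) else 0 := by
    intro r
    rw [cnt_trapWalk hn le_rfl]
    split_ifs
    · simp only [bentB]; exact_mod_cast min_eq_right hn
    · simp [bentB]
  refine (Finset.sum_congr rfl fun r _ => h_term r).trans ?_
  exact (sum_ite_sharedSet 1).trans (mul_one _)

lemma factorial_mul_harmonic_le_maxW :
    n.factorial * ∑ i ∈ range n, (1 / ((i : ℝ) + 1)) ≤ (trapGame n hn).maxW := by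
  have h_valid : (trapGame n hn).Valid (privateSet n) := fun i => by simp [trapGame]
  refine le_trans ?_ ((trapGame n hn).le_maxW h_valid)
  have h_cnt : ∀ r, (if r ∈ univ.biUnion (privateSet n) then (1 : ℝ) else 0) ≤
      bentB 1 ((trapGame n hn).cnt (privateSet n) r) := by
    intro r
    split_ifs with hr
    · obtain ⟨i, -, hi⟩ := mem_biUnion.1 hr
      have h_pos : 1 ≤ (trapGame n hn).cnt (privateSet n) r :=
        card_pos.2 ⟨i, mem_filter.2 ⟨mem_univ _, hi⟩⟩
      simp only [bentB]
      exact_mod_cast le_min h_pos le_rfl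
    · exact Nat.cast_nonneg _
  refine le_trans (le_of_eq ?_) (Finset.sum_le_sum fun r _ => h_cnt r)
  rw [Finset.mul_sum, Finset.sum_range, Finset.sum_ite_mem, univ_inter,
    sum_const, card_biUnion fun i _ j _ h => disjoint_private_private h, nsmul_eq_mul, mul_one,
    Nat.cast_sum]
  exact Finset.sum_congr rfl fun i _ => (cast_card_privateSet i).symm

lemma isWalk_trapWalk (h_mono : Monotone (uB 1)) : (trapGame n hn).IsWalk n (trapWalk n) := by
  refine ⟨by funext i; simp [trapWalk], fun τ hτ => ?_⟩
  have h_player : (trapGame n hn).player τ = (⟨τ, hτ⟩ : Fin n) :=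
    Fin.ext (Nat.mod_eq_of_lt hτ)
  unfold ResGame.Step
  rw [h_player]
  have h_idle : trapWalk n τ ⟨τ, hτ⟩ = ∅ := by simp [trapWalk]
  have h_move : trapWalk n (τ + 1) ⟨τ, hτ⟩ = sharedSet n := by simp [trapWalk]
  refine ⟨?_, fun i hi => ?_⟩
  swap
  · have h_ne : (i : ℕ) ≠ τ := fun h => hi (Fin.ext h)
    change trapWalk n (τ + 1) i = trapWalk n τ i
    simp only [trapWalk]
    congr 1
    exact propext (by omega)
  have h_U : ∀ b, (trapGame n hn).U (Function.update (trapWalk n τ) ⟨τ, hτ⟩ b) =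
      ∑ r : Fin ((n + 1) * (2 * n.factorial)),
        uB 1 ((if r ∈ sharedSet n then τ else 0) + if r ∈ b then 1 else 0) := by
    intro b
    refine Finset.sum_congr rfl fun r _ => ?_
    rw [(trapGame n hn).cnt_update_of_eq_empty _ _ h_idle, cnt_trapWalk hn hτ.le]
  have h_zero : uB 1 0 = 0 := by simp [uB]
  have h_one : uB 1 1 = 1 := by simp [uB, fB]
  have h_shared : (trapGame n hn).U
      (Function.update (trapWalk n τ) ⟨τ, hτ⟩ (sharedSet n)) =
        2 * n.factorial * uB 1 (τ + 1) := by
    rw [h_U, ← sum_ite_sharedSet]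
    refine Finset.sum_congr rfl fun r _ => ?_
    split_ifs <;> simp [h_zero]
  have h_empty : (trapGame n hn).U (Function.update (trapWalk n τ) ⟨τ, hτ⟩ ∅) =
      2 * n.factorial * uB 1 τ := by
    rw [h_U, ← sum_ite_sharedSet]
    refine Finset.sum_congr rfl fun r _ => ?_
    split_ifs <;> simp_all
  have h_private : (trapGame n hn).U
      (Function.update (trapWalk n τ) ⟨τ, hτ⟩ (privateSet n ⟨τ, hτ⟩)) =
        2 * n.factorial * uB 1 τ + n.factorial * (1 / ((τ : ℝ) + 1)) := by
    rw [h_U, ← sum_ite_sharedSet, ← cast_card_privateSet ⟨τ, hτ⟩, ← nsmul_one,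
      ← sum_const, ← univ_inter (privateSet n ⟨τ, hτ⟩), ← Finset.sum_ite_mem,
      ← Finset.sum_add_distrib, univ_inter]
    refine Finset.sum_congr rfl fun r _ => ?_
    by_cases hr : r ∈ sharedSet n
    · have hr' := Finset.disjoint_left.1 (disjoint_shared_private ⟨τ, hτ⟩) hr
      simp [hr, hr']
    · by_cases hr' : r ∈ privateSet n ⟨τ, hτ⟩ <;> simp [hr, hr', h_zero, h_one]
  have h_gain : uB 1 τ + 1 / 2 * (1 / ((τ : ℝ) + 1)) ≤ uB 1 (τ + 1) := by
    rw [uB_succ]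
    have h_marginal := one_le_two_mul_fB_one h_mono τ
    have h_div : 1 / ((τ : ℝ) + 1) ≤ 2 * fB 1 (τ + 1) := by
      rw [div_le_iff₀ (by positivity)]
      linarith
    linarith
  have h_fact : (0 : ℝ) < n.factorial := by positivity
  refine ⟨?_, fun b hb => ?_⟩
  · change trapWalk n (τ + 1) ⟨τ, hτ⟩ ∈ ({∅, sharedSet n, privateSet n ⟨τ, hτ⟩} : Finset _)
    simp [h_move]
  · rw [show trapWalk n (τ + 1) (⟨τ, hτ⟩ : Fin n) = sharedSet n from h_move]
    change b ∈ ({∅, sharedSet n, privateSet n ⟨τ, hτ⟩} : Finset _) at hb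
    simp only [mem_insert, mem_singleton] at hb
    rcases hb with rfl | rfl | rfl
    · rw [h_shared]
      refine h_empty.trans_le ?_
      exact mul_le_mul_of_nonneg_left (h_mono (Nat.le_succ τ)) (by positivity)
    · exact le_rfl
    · rw [h_shared, h_private]
      nlinarith

end Trap

end OneRoundWalk

/-- Any utility design on the welfare rules of curvature at most
`1` assigning to each bent welfare rule `min(·,b)` the asymptotically optimal
distribution rule `u_b` has one-round guarantee `pob(𝒲, Γ*∞; 1) = 0`: for every
`ε > 0` there is a game in the class and a one-round walk from the empty joint
action whose final joint action has efficiency less than `ε`. -/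
theorem stmt9 (Γ : (ℕ → ℝ) → (ℕ → ℝ)) (hΓ : IsUtilityDesign (curvW 1) Γ)
    (hΓb : ∀ b : ℕ, 1 ≤ b → Γ (bentB b) = uB b) :
    pobClass (curvW 1) Γ 1 = 0 ∧
    ∀ ε > (0 : ℝ), ∃ (G : ResGame) (traj : ℕ → Fin G.n → Finset (Fin G.d)),
      InClass (curvW 1) Γ G ∧ G.IsWalk (1 * G.n) traj ∧
      G.eff (traj (1 * G.n)) < ε := by
  have h_mono : Monotone (uB 1) := hΓb 1 le_rfl ▸ (hΓ _ bentB_one_mem_curvW).2.2.1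
  have h_game : ∀ ε > (0 : ℝ), ∃ (G : ResGame) (traj : ℕ → Fin G.n → Finset (Fin G.d)),
      InClass (curvW 1) Γ G ∧ G.IsWalk (1 * G.n) traj ∧ G.eff (traj (1 * G.n)) < ε := by
    intro ε hε
    obtain ⟨n, h_harm, hn⟩ :=
      ((Real.tendsto_sum_range_one_div_nat_succ_atTop.eventually_gt_atTop (2 / ε)).and
        (Filter.eventually_gt_atTop 0)).exists
    refine ⟨trapGame n hn, trapWalk n,
      fun _ => ⟨bentB_one_mem_curvW, (hΓb 1 le_rfl).symm⟩, ?_, ?_⟩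
    · rw [one_mul]
      exact isWalk_trapWalk hn h_mono
    · rw [one_mul]
      have h_max := factorial_mul_harmonic_le_maxW hn
      have h_fact : (0 : ℝ) < n.factorial := by positivity
      rw [div_lt_iff₀ hε] at h_harm
      change (trapGame n hn).W (trapWalk n n) / (trapGame n hn).maxW < ε
      have h_lt : 2 * (n.factorial : ℝ) < ε * (trapGame n hn).maxW := by
        nlinarith [mul_le_mul_of_nonneg_left h_max hε.le, mul_lt_mul_of_pos_left h_harm h_fact]
      have h_pos : 0 < (trapGame n hn).maxW :=
        pos_of_mul_pos_right (lt_trans (by positivity) h_lt) hε.le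
      rwa [W_trapWalk, div_lt_iff₀ h_pos]
  refine ⟨le_antisymm (le_of_forall_pos_lt_add fun ε hε => ?_) ?_, h_game⟩
  · obtain ⟨G, traj, hG, h_walk, h_eff⟩ := h_game ε hε
    rw [zero_add]
    refine lt_of_le_of_lt (csInf_le ⟨0, ?_⟩ ⟨G, hG, rfl⟩)
      ((ResGame.pob_le_eff hG h_walk).trans_lt h_eff)
    rintro _ ⟨G', hG', rfl⟩
    exact ResGame.pob_nonneg hG' 1
  · refine Real.sInf_nonneg ?_
    rintro _ ⟨G, hG, rfl⟩
    exact ResGame.pob_nonneg hG 1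
end

section
/- Fix an integer b ≥ 1 and set ρ_b = (1 − b^b e^{−b}/b!)^{−1}. Define the sequence f by f(1) = 1 and f(j+1) = (1/b)(j·f(j) − ρ_b·min(j,b)) + 1 for j ≥ 1. Then for every integer t ≥ b, f(t) = (ρ_b − 1) · ((t−1)!/b^{t−1}) · Σ_{T=t}^{∞} b^T/T!. -/
/-- The strict inequality `b^b / b! < e^b`. -/
lemma pow_self_div_factorial_lt_exp {b : ℕ} (hb : 1 ≤ b) :
    (b : ℝ) ^ b / (Nat.factorial b : ℝ) < Real.exp b := by
  have h := Real.sum_le_exp_of_nonneg (x := (b : ℝ)) (Nat.cast_nonneg b) (b + 1)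
  rw [Finset.sum_range_succ] at h
  have hpos : 0 < ∑ i ∈ Finset.range b, (b : ℝ) ^ i / (Nat.factorial i : ℝ) := by
    have hb' : (0 : ℝ) < b := by exact_mod_cast hb
    exact Finset.sum_pos (fun i _ => by positivity) ⟨0, Finset.mem_range.mpr hb⟩
  linarith

/-- The defining identity of `ρ_b`, cleared of denominators. -/
lemma rhoB_mul_pow_div_factorial {b : ℕ} (hb : 1 ≤ b) :
    rhoB b * ((b : ℝ) ^ b / (Nat.factorial b : ℝ)) = (rhoB b - 1) * Real.exp b := by
  have h := pow_self_div_factorial_lt_exp hb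
  have hE : (0 : ℝ) < Real.exp b := Real.exp_pos _
  have hrho : rhoB b =
      Real.exp b / (Real.exp b - (b : ℝ) ^ b / (Nat.factorial b : ℝ)) := by
    have hne : Real.exp b - (b : ℝ) ^ b / (Nat.factorial b : ℝ) ≠ 0 := by linarith
    rw [rhoB, ← inv_div, Real.exp_neg]
    field_simp
  have hne : Real.exp b - (b : ℝ) ^ b / (Nat.factorial b : ℝ) ≠ 0 := by linarith
  rw [hrho, div_sub_one hne]
  ring

/-- The tail of the exponential series. -/
lemma tsum_pow_div_factorial_tail (x : ℝ) (t : ℕ) :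
    ∑' T : ℕ, x ^ (T + t) / (Nat.factorial (T + t) : ℝ) =
      Real.exp x - ∑ T ∈ Finset.range t, x ^ T / (Nat.factorial T : ℝ) := by
  have h := (Real.summable_pow_div_factorial x).sum_add_tsum_nat_add t
  have hexp : Real.exp x = ∑' n : ℕ, x ^ n / (Nat.factorial n : ℝ) := by
    rw [Real.exp_eq_exp_ℝ, NormedSpace.exp_eq_tsum_div]
  rw [hexp, ← h]
  ring

/-- The closed form of `f_b` on the initial segment, where `min(j,b) = j`. -/
lemma fB_succ_of_le {b : ℕ} (hb : 1 ≤ b) {n : ℕ} (hn : n ≤ b) :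
    fB b (n + 1) = (Nat.factorial n : ℝ) / (b : ℝ) ^ n *
      (∑ T ∈ Finset.range (n + 1), (b : ℝ) ^ T / (Nat.factorial T : ℝ) -
        rhoB b * ∑ T ∈ Finset.range n, (b : ℝ) ^ T / (Nat.factorial T : ℝ)) := by
  have hb' : (b : ℝ) ≠ 0 := by exact_mod_cast (by omega : b ≠ 0)
  induction n with
  | zero => simp [fB]
  | succ n ih =>
    have hf : (Nat.factorial n : ℝ) ≠ 0 := by positivity
    rw [fB, ih (by omega), min_eq_left hn, Finset.sum_range_succ _ (n + 1),
      Finset.sum_range_succ _ n, Nat.factorial_succ]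
    push_cast
    field_simp
    ring

/-- Closed form for `f_b`: for every `t ≥ b`,
`f_b(t) = (ρ_b − 1) · ((t−1)!/b^{t−1}) · Σ_{T=t}^{∞} b^T/T!`. -/
theorem stmt10 (b : ℕ) (hb : 1 ≤ b) (t : ℕ) (ht : b ≤ t) :
    fB b t = (rhoB b - 1) * ((Nat.factorial (t - 1) : ℝ) / (b : ℝ) ^ (t - 1)) *
      ∑' T : ℕ, (b : ℝ) ^ (T + t) / (Nat.factorial (T + t) : ℝ) := by
  rw [tsum_pow_div_factorial_tail]
  have hb' : (b : ℝ) ≠ 0 := by exact_mod_cast (by omega : b ≠ 0)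
  induction t, ht using Nat.le_induction with
  | base =>
    have hrho := rhoB_mul_pow_div_factorial hb
    obtain ⟨n, rfl⟩ : ∃ n, b = n + 1 := ⟨b - 1, by omega⟩
    have hpow : ((n + 1 : ℕ) : ℝ) ^ (n + 1) / (Nat.factorial (n + 1) : ℝ) =
        ((n + 1 : ℕ) : ℝ) ^ n / (Nat.factorial n : ℝ) := by
      rw [pow_succ, Nat.factorial_succ, Nat.cast_mul]
      field_simp
    rw [hpow] at hrho
    rw [fB_succ_of_le hb (Nat.le_succ n), Nat.add_sub_cancel, Finset.sum_range_succ _ n]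
    linear_combination (Nat.factorial n : ℝ) / ((n + 1 : ℕ) : ℝ) ^ n * hrho
  | succ t ht ih =>
    obtain ⟨n, rfl⟩ : ∃ n, t = n + 1 := ⟨t - 1, by omega⟩
    have hf : (Nat.factorial n : ℝ) ≠ 0 := by positivity
    rw [fB, ih, min_eq_right ht, Finset.sum_range_succ _ (n + 1), Nat.add_sub_cancel,
      Nat.add_sub_cancel, Nat.factorial_succ]
    push_cast
    field_simp
    ring
end

section
/- Let χ ≥ 0 and define f_χ by f_χ(1) = 1 and f_χ(j+1) = max{ j·f_χ(j) − χ, 0 } for j ≥ 1. If g : {1,2,…} → ℝ satisfies g(1) = 1, g(j) ≥ 0 for all j ≥ 1, and j·g(j) − g(j+1) ≤ χ for all j ≥ 1, then f_χ(j) ≤ g(j) for every j ≥ 1. (Thus f_χ is the pointwise-minimal utility rule subject to the constraint sup_j { j·f(j) − f(j+1) } ≤ χ, which corresponds to asymptotic efficiency at least 1/(1+χ) in set covering games.) -/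
/-- The extremal set-covering utility rule for the constraint
`j·f(j) − f(j+1) ≤ χ` : `f_χ(1) = 1`, `f_χ(j+1) = max{ j·f_χ(j) − χ, 0 }`. -/
noncomputable def fchi (χ : ℝ) : ℕ → ℝ
  | 0 => 0
  | 1 => 1
  | (j + 2) => max ((j + 1 : ℝ) * fchi χ (j + 1) - χ) 0

/-- `f_χ` is the pointwise-minimal sequence with `g(1) = 1`,
`g ≥ 0`, and `j·g(j) − g(j+1) ≤ χ` for all `j ≥ 1`. -/
theorem stmt15 (χ : ℝ) (hχ : 0 ≤ χ) (g : ℕ → ℝ) (hg1 : g 1 = 1)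
    (hgnn : ∀ j : ℕ, 1 ≤ j → 0 ≤ g j)
    (hgc : ∀ j : ℕ, 1 ≤ j → (j : ℝ) * g j - g (j + 1) ≤ χ) :
    ∀ j : ℕ, 1 ≤ j → fchi χ j ≤ g j := by
  intro j hj
  induction j, hj using Nat.le_induction with
  | base => simp [fchi, hg1]
  | succ n hn ih =>
    obtain ⟨k, rfl⟩ := Nat.exists_eq_add_of_le' hn
    refine max_le ?_ (hgnn _ (by omega))
    have hc := hgc (k + 1) hn
    push_cast at hc
    have hm : (k + 1 : ℝ) * fchi χ (k + 1) ≤ (k + 1 : ℝ) * g (k + 1) := by gcongr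
    linarith
end

section
/- Let χ ≥ 0 and define f_χ by f_χ(1) = 1 and f_χ(j+1) = max{ j·f_χ(j) − χ, 0 } for j ≥ 1. Then for every j ≥ 1, f_χ(j) = max{ (j−1)!·(1 − χ·Σ_{τ=1}^{j−1} 1/τ!), 0 }. -/
theorem max_mul_max_sub_zero {a b c : ℝ} (ha : 0 ≤ a) (hc : 0 ≤ c) :
    max (a * max b 0 - c) 0 = max (a * b - c) 0 := by
  rcases le_total b 0 with hb | hb
  · have hab : a * b ≤ 0 := mul_nonpos_of_nonneg_of_nonpos ha hb
    rw [max_eq_right hb, max_eq_right (by linarith), max_eq_right (by linarith)]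
  · rw [max_eq_left hb]

/-- Closed form:
`f_χ(j) = max{ (j−1)!·(1 − χ·Σ_{τ=1}^{j−1} 1/τ!), 0 }` for every `j ≥ 1`. -/
theorem stmt17 (χ : ℝ) (hχ : 0 ≤ χ) (j : ℕ) (hj : 1 ≤ j) :
    fchi χ j = max ((Nat.factorial (j - 1) : ℝ) *
      (1 - χ * ∑ τ ∈ Finset.Icc 1 (j - 1), (1 : ℝ) / (Nat.factorial τ : ℝ))) 0 := by
  induction j, hj using Nat.le_induction with
  | base => simp [fchi]
  | succ j hj ih =>
    obtain ⟨n, rfl⟩ := Nat.exists_eq_add_of_le' hj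
    simp only [Nat.add_sub_cancel] at ih ⊢
    rw [fchi, ih, max_mul_max_sub_zero (by positivity) hχ,
      Finset.sum_Icc_succ_top (by omega), Nat.factorial_succ]
    congr 1
    have hn : (Nat.factorial n : ℝ) ≠ 0 := by positivity
    push_cast
    field_simp
    ring
end

section
/- Let χ = 1/(e−1) and define f_χ by f_χ(1) = 1 and f_χ(j+1) = max{ j·f_χ(j) − χ, 0 } for j ≥ 1. Then for every j ≥ 1, f_χ(j) = χ·(j−1)!·Σ_{τ=j}^{∞} 1/τ! ≥ χ/j > 0, and consequently the series Σ_{j=1}^{∞} f_χ(j) diverges to +∞. (This corresponds to the one-round efficiency guarantee dropping to 0 for the asymptotically optimal set-covering utility rule.) -/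
/-- The tail `Σ_{τ ≥ j} 1/τ!` of the exponential series. -/
noncomputable def expTail (j : ℕ) : ℝ := ∑' τ : ℕ, (1 : ℝ) / (Nat.factorial (τ + j) : ℝ)

theorem summable_one_div_factorial_add (j : ℕ) :
    Summable fun τ : ℕ => (1 : ℝ) / (Nat.factorial (τ + j) : ℝ) := by
  have h : Summable fun τ : ℕ => (1 : ℝ) / (Nat.factorial τ : ℝ) := by
    simpa using Real.summable_pow_div_factorial 1
  exact (summable_nat_add_iff j).2 h

theorem expTail_eq_add (j : ℕ) :
    expTail j = 1 / (Nat.factorial j : ℝ) + expTail (j + 1) := by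
  rw [expTail, (summable_one_div_factorial_add j).tsum_eq_zero_add, expTail, Nat.zero_add]
  simp only [Nat.add_assoc, Nat.add_comm 1]

theorem expTail_zero : expTail 0 = Real.exp 1 := by
  rw [Real.exp_eq_exp_ℝ, NormedSpace.exp_eq_tsum_div]
  simp [expTail]

theorem expTail_nonneg (j : ℕ) : 0 ≤ expTail j :=
  tsum_nonneg fun _ => by positivity

theorem fchi_succ_eq {χ : ℝ} (hχ : χ = 1 / (Real.exp 1 - 1)) (j : ℕ) :
    fchi χ (j + 1) = χ * (Nat.factorial j : ℝ) * expTail (j + 1) := by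
  have he : 0 < Real.exp 1 - 1 := by
    have := Real.add_one_lt_exp (one_ne_zero (α := ℝ))
    linarith
  have hpos : 0 ≤ χ := hχ ▸ by positivity
  induction j with
  | zero =>
    have h := expTail_eq_add 0
    rw [expTail_zero] at h
    have h' : expTail (0 + 1) = Real.exp 1 - 1 := by
      rw [h]
      simp
    rw [h', hχ]
    simp [fchi, he.ne']
  | succ j ih =>
    have hfac : (Nat.factorial (j + 1) : ℝ) ≠ 0 := by positivity
    have key : ((j : ℝ) + 1) * fchi χ (j + 1) - χ =
        χ * (Nat.factorial (j + 1) : ℝ) * expTail (j + 1 + 1) := by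
      have hcast : (Nat.factorial (j + 1) : ℝ) = ((j : ℝ) + 1) * (Nat.factorial j : ℝ) := by
        push_cast [Nat.factorial_succ]
        ring
      have hmul : (Nat.factorial (j + 1) : ℝ) * expTail (j + 1) =
          1 + (Nat.factorial (j + 1) : ℝ) * expTail (j + 1 + 1) := by
        rw [expTail_eq_add (j + 1), mul_add, mul_one_div_cancel hfac]
      rw [ih]
      linear_combination χ * hmul - χ * expTail (j + 1) * hcast
    rw [fchi, key]
    exact max_eq_left (mul_nonneg (by positivity) (expTail_nonneg _))

theorem div_le_fchi_succ {χ : ℝ} (hχ : χ = 1 / (Real.exp 1 - 1)) (hpos : 0 < χ) (j : ℕ) :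
    χ / ((j + 1 : ℕ) : ℝ) ≤ fchi χ (j + 1) := by
  have hle : 1 / (Nat.factorial (j + 1) : ℝ) ≤ expTail (j + 1) := by
    rw [expTail_eq_add (j + 1)]
    linarith [expTail_nonneg (j + 1 + 1)]
  have heq : χ / ((j + 1 : ℕ) : ℝ) =
      χ * (Nat.factorial j : ℝ) * (1 / (Nat.factorial (j + 1) : ℝ)) := by
    have hfac : (Nat.factorial j : ℝ) ≠ 0 := by positivity
    rw [Nat.factorial_succ, Nat.cast_mul]
    field_simp
  rw [fchi_succ_eq hχ, heq]
  gcongr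

/-- For `χ = 1/(e−1)` : for every `j ≥ 1`,
`f_χ(j) = χ·(j−1)!·Σ_{τ=j}^{∞} 1/τ! ≥ χ/j > 0`, and consequently
`Σ_{j=1}^{∞} f_χ(j)` diverges to `+∞`. -/
theorem stmt18 (χ : ℝ) (hχ : χ = 1 / (Real.exp 1 - 1)) :
    (∀ j : ℕ, 1 ≤ j →
      fchi χ j = χ * (Nat.factorial (j - 1) : ℝ) *
          ∑' τ : ℕ, (1 : ℝ) / (Nat.factorial (τ + j) : ℝ) ∧
        χ / j ≤ fchi χ j ∧ 0 < fchi χ j) ∧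
    Filter.Tendsto (fun N : ℕ => ∑ j ∈ Finset.Icc 1 N, fchi χ j)
      Filter.atTop Filter.atTop := by
  have hpos : 0 < χ := by
    have := Real.add_one_lt_exp (one_ne_zero (α := ℝ))
    rw [hχ]
    exact one_div_pos.2 (by linarith)
  refine ⟨fun j hj => ?_, ?_⟩
  · obtain ⟨k, rfl⟩ := Nat.exists_eq_add_of_le' hj
    have hle := div_le_fchi_succ hχ hpos k
    exact ⟨fchi_succ_eq hχ k, hle, lt_of_lt_of_le (by positivity) hle⟩
  · have hharm := Real.tendsto_sum_range_one_div_nat_succ_atTop.const_mul_atTop hpos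
    refine Filter.tendsto_atTop_mono (fun N => ?_) hharm
    rw [← Finset.Ico_add_one_right_eq_Icc, Finset.sum_Ico_eq_sum_range, Finset.mul_sum,
      Nat.add_sub_cancel]
    refine Finset.sum_le_sum fun i _ => ?_
    rw [Nat.add_comm 1 i, mul_one_div]
    exact_mod_cast div_le_fchi_succ hχ hpos i
end

section
/- Let χ > 1/(e−1) and define f_χ by f_χ(1) = 1 and f_χ(j+1) = max{ j·f_χ(j) − χ, 0 } for j ≥ 1. Then there exists an integer J ≥ 1 such that f_χ(j) = 0 for all j ≥ J, and consequently the series Σ_{j=1}^{∞} f_χ(j) converges to a finite value. -/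
theorem fchi_nonneg (χ : ℝ) : ∀ j, 0 ≤ fchi χ j
  | 0 => by simp [fchi]
  | 1 => by simp [fchi]
  | (j + 2) => by
    rw [fchi]
    exact le_max_right _ _

theorem fchi_succ_le {χ : ℝ} (hχ : 0 ≤ χ) (n : ℕ) :
    fchi χ (n + 1) ≤
      max ((n.factorial : ℝ) *
        (1 - χ * (∑ i ∈ Finset.range (n + 1), 1 / (i.factorial : ℝ) - 1))) 0 := by
  induction n with
  | zero => simp [fchi]
  | succ n ih =>
    rw [fchi]
    refine max_le ?_ (le_max_right _ _)
    have hn : (0 : ℝ) ≤ n + 1 := by positivity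
    rcases le_max_iff.mp ih with h | h
    · refine le_max_of_le_left ?_
      have hm := mul_le_mul_of_nonneg_left h hn
      have hf : (n.factorial : ℝ) ≠ 0 := by positivity
      rw [Finset.sum_range_succ _ (n + 1), Nat.factorial_succ]
      push_cast
      refine (sub_le_sub_right hm χ).trans_eq ?_
      field_simp
      ring
    · refine le_max_of_le_right ?_
      linarith [mul_nonpos_of_nonneg_of_nonpos hn h]

/-- For `χ > 1/(e−1)`, `f_χ` is eventually zero, and
consequently the series `Σ_{j=1}^{∞} f_χ(j)` converges to a finite value. -/
theorem stmt19 (χ : ℝ) (hχ : 1 / (Real.exp 1 - 1) < χ) :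
    ∃ J : ℕ, 1 ≤ J ∧ (∀ j, J ≤ j → fchi χ j = 0) ∧
      Summable (fun j : ℕ => fchi χ j) := by
  have he : 0 < Real.exp 1 - 1 := by linarith [Real.add_one_le_exp (1 : ℝ)]
  have hχ0 : 0 < χ := (one_div_pos.mpr he).trans hχ
  have hsum : HasSum (fun i : ℕ => 1 / (i.factorial : ℝ)) (Real.exp 1) := by
    rw [Real.exp_eq_exp_ℝ]
    simpa using NormedSpace.expSeries_div_hasSum_exp (1 : ℝ)
  have hlim := hsum.tendsto_sum_nat.comp (Filter.tendsto_add_atTop_nat 1)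
  have hlt : 1 + 1 / χ < Real.exp 1 := by
    have := (one_div_lt he hχ0).mp hχ
    linarith
  obtain ⟨N, hN⟩ := Filter.eventually_atTop.mp (hlim.eventually_const_lt hlt)
  have hzero : ∀ j, N + 1 ≤ j → fchi χ j = 0 := by
    intro j hj
    obtain ⟨n, rfl⟩ : ∃ n, j = n + 1 := ⟨j - 1, by omega⟩
    refine le_antisymm ((fchi_succ_le hχ0.le n).trans (max_le ?_ le_rfl)) (fchi_nonneg χ _)
    refine mul_nonpos_of_nonneg_of_nonpos (by positivity) ?_
    have h : 1 / χ < ∑ i ∈ Finset.range (n + 1), 1 / (i.factorial : ℝ) - 1 :=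
      lt_sub_iff_add_lt'.mpr (hN n (by omega))
    rw [div_lt_iff₀' hχ0] at h
    linarith
  refine ⟨N + 1, by omega, hzero, ?_⟩
  refine summable_of_ne_finset_zero (s := Finset.range (N + 1)) fun j hj => hzero j ?_
  simpa using hj
end
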